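/- Let X, X', and Y be compactly generated weakly Hausdorff topological spaces. Let f : X' → X be a quotient map (f is surjective and a set V ⊆ X is closed if and only if f⁻¹(V) is closed in X'), and let g : Y → X be continuous. Form the pullback Y' = {(y, x') ∈ Y × X' | g(y) = f(x')} with the subspace topology of the product, and let h : Y' → Y be the first projection. Then h induces the compactly generated topology on Y; precisely, a subset V ⊆ Y is closed in Y if and only if for every compact Hausdorff space L and every continuous map w : L → Y', the preimage w⁻¹(h⁻¹(V)) is closed in L. -/

import Mathlib

/-- A topological space `Z` is weakly Hausdorff if for every compact Hausdorff
space `K` and every continuous map `u : K → Z`, the image of `u` is closed. -/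
def WeaklyHausdorffSpace (Z : Type) [TopologicalSpace Z] : Prop :=
  ∀ (K : Type) [TopologicalSpace K] [CompactSpace K] [T2Space K]
    (u : K → Z), Continuous u → IsClosed (Set.range u)

/-- A topological space `Z` is compactly generated if a set is closed in `Z`
exactly when its preimage under every continuous map from a compact Hausdorff
space is closed. -/
def IsCompactlyGeneratedSpace (Z : Type) [TopologicalSpace Z] : Prop :=
  ∀ V : Set Z, IsClosed V ↔
    ∀ (K : Type) [TopologicalSpace K] [CompactSpace K] [T2Space K]
      (u : K → Z), Continuous u → IsClosed (u ⁻¹' V)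

/-- In a weakly Hausdorff space, the pairs at which two continuous maps from compact Hausdorff
spaces agree form a closed set. -/
theorem WeaklyHausdorffSpace.isClosed_setOf_eq {X K S : Type} [TopologicalSpace X]
    (hX : WeaklyHausdorffSpace X) [TopologicalSpace K]
    [TopologicalSpace S] [CompactSpace S] [T2Space S]
    {p : K → X} {q : S → X} (hp : Continuous p) (hq : Continuous q) :
    IsClosed {z : K × S | p z.1 = q z.2} := by
  rw [← isOpen_compl_iff, isOpen_iff_mem_nhds]
  rintro ⟨k, s⟩ hks
  have hpt : IsClosed {p k} := by
    simpa using hX Unit (fun _ => p k) continuous_const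
  obtain ⟨W, hW, hWc, hWsub⟩ := exists_mem_nhds_isClosed_subset
    ((hpt.preimage hq).isOpen_compl.mem_nhds (x := s) fun hs => hks (Eq.symm hs))
  have hqW : IsClosed (q '' W) := by
    have : CompactSpace W := isCompact_iff_compactSpace.mp hWc.isCompact
    simpa [Set.range_comp] using hX W (q ∘ Subtype.val) (hq.comp continuous_subtype_val)
  have hU : (p ⁻¹' (q '' W))ᶜ ∈ nhds k := by
    refine (hqW.preimage hp).isOpen_compl.mem_nhds ?_
    rintro ⟨t, ht, htk⟩
    exact hWsub ht htk
  filter_upwards [prod_mem_nhds hU hW] with z hz heq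
  exact hz.1 ⟨z.2, hz.2, Eq.symm heq⟩

/-- Continuity of a map out of a compactly generated space can be tested on continuous maps from
compact Hausdorff spaces. -/
theorem IsCompactlyGeneratedSpace.continuous_of_comp {X Z : Type} [TopologicalSpace X]
    [TopologicalSpace Z] (hX : IsCompactlyGeneratedSpace X) {F : X → Z}
    (hF : ∀ (K : Type) [TopologicalSpace K] [CompactSpace K] [T2Space K] (u : K → X),
      Continuous u → Continuous (F ∘ u)) : Continuous F :=
  continuous_iff_isClosed.mpr fun _ hC =>
    (hX _).mpr fun K _ _ _ u hu => hC.preimage (hF K u hu)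

/-- A subset of a compact Hausdorff space `K` over `X` is closed if, for a quotient map
`f : X' → X` from a compactly generated space, its pullback to `K × S` is closed for every
compact Hausdorff space `S` over `X'`. -/
theorem IsCompactlyGeneratedSpace.isClosed_of_isQuotientMap {X X' K : Type} [TopologicalSpace X]
    [TopologicalSpace X'] [TopologicalSpace K] [CompactSpace K] [T2Space K]
    (hX' : IsCompactlyGeneratedSpace X') {f : X' → X} (hf : Topology.IsQuotientMap f)
    {p : K → X} (hp : Continuous p) {A : Set K}
    (hA : ∀ (S : Type) [TopologicalSpace S] [CompactSpace S] [T2Space S] (u : S → X'),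
      Continuous u → IsClosed {z : K × S | p z.1 = f (u z.2) ∧ z.1 ∈ A}) :
    IsClosed A := by
  have hfib (x : X) : Continuous fun k => ¬ (p k = x ∧ k ∈ A) := by
    obtain ⟨x', rfl⟩ := hf.surjective x
    refine continuous_Prop.mpr (isClosed_compl_iff.mp ?_)
    convert (hA Unit (fun _ => x') continuous_const).preimage
      (continuous_id.prodMk continuous_const : Continuous fun k : K => (k, ())) using 1
    ext k
    simp
  let F : X → C(K, Prop) := fun x => ⟨fun k => ¬ (p k = x ∧ k ∈ A), hfib x⟩
  have hF : Continuous F := by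
    refine hf.continuous_iff.mpr (hX'.continuous_of_comp fun S _ _ _ u hu => ?_)
    refine ContinuousMap.continuous_of_continuous_uncurry _ (continuous_Prop.mpr ?_)
    rw [← isClosed_compl_iff]
    convert (hA S u hu).preimage continuous_swap using 1
    ext z
    simp [F, Function.uncurry]
  have hdiag : Continuous fun k => F (p k) k := by fun_prop
  rw [← isOpen_compl_iff]
  convert continuous_Prop.mp hdiag using 1
  ext k
  simp [F]

/-- Pullbacks along continuous maps preserve quotient maps, in the sense that the
pulled back map induces the compactly generated topology on its target, in the
category of compactly generated weakly Hausdorff spaces. -/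
theorem pullback_of_quotient_induces_compactly_generated_topology
    {X X' Y : Type} [TopologicalSpace X] [TopologicalSpace X'] [TopologicalSpace Y]
    (hXcg : IsCompactlyGeneratedSpace X) (hXwh : WeaklyHausdorffSpace X)
    (hX'cg : IsCompactlyGeneratedSpace X') (hX'wh : WeaklyHausdorffSpace X')
    (hYcg : IsCompactlyGeneratedSpace Y) (hYwh : WeaklyHausdorffSpace Y)
    (f : X' → X) (hfcont : Continuous f) (hfsurj : Function.Surjective f)
    (hfquot : ∀ V : Set X, IsClosed V ↔ IsClosed (f ⁻¹' V))
    (g : Y → X) (hg : Continuous g)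
    (h : {p : Y × X' // g p.1 = f p.2} → Y)
    (hh : ∀ p, h p = p.1.1) :
    ∀ V : Set Y, IsClosed V ↔
      ∀ (L : Type) [TopologicalSpace L] [CompactSpace L] [T2Space L]
        (w : L → {p : Y × X' // g p.1 = f p.2}), Continuous w →
          IsClosed (w ⁻¹' (h ⁻¹' V)) := by
  intro V
  have hh' : Continuous h := by
    rw [funext hh]
    fun_prop
  refine ⟨fun hV L _ _ _ w hw => (hV.preimage hh').preimage hw, fun hV => ?_⟩
  refine (hYcg V).mpr fun K _ _ _ u hu => ?_
  have hf : Topology.IsQuotientMap f :=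
    Topology.isQuotientMap_iff_isClosed.mpr ⟨hfsurj, hfquot⟩
  refine hX'cg.isClosed_of_isQuotientMap hf (hg.comp hu) fun S _ _ _ v hv => ?_
  have hE := hXwh.isClosed_setOf_eq (hg.comp hu) (hfcont.comp hv)
  set E := {z : K × S | (g ∘ u) z.1 = (f ∘ v) z.2}
  have : CompactSpace E := isCompact_iff_compactSpace.mp hE.isCompact
  have hVE := hV E (fun z => ⟨(u z.1.1, v z.1.2), z.2⟩) (by fun_prop)
  convert hE.isClosedEmbedding_subtypeVal.isClosedMap _ hVE using 1
  ext z
  simp [hh, E, and_comm]
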